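/- Let q ∈ ℂ be a root of unity (i.e. q^m = 1 for some positive integer m), and let n be the smallest positive integer such that q^n = 1 or q^n = -1. Then the Dickson polynomial of the first kind with parameter 1, D_n = Polynomial.dickson 1 1 n over ℂ, satisfies D_n(-(q + q⁻¹)) = -q^{n^2} - (q^{n^2})⁻¹. -/

import Mathlib

/-- The value `D_n(-(q + q⁻¹)) = (-1)^n (q^n + q^{-n})` of the Dickson polynomial. -/
theorem dickson_one_one_eval_neg_add_inv {K : Type*} [Field K] {q : K} (hq : q ≠ 0) (n : ℕ) :
    (Polynomial.dickson 1 (1 : K) n).eval (-(q + q⁻¹)) = (-1) ^ n * (q ^ n + (q ^ n)⁻¹) := by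
  have h : -q * -q⁻¹ = 1 := by rw [neg_mul_neg, mul_inv_cancel₀ hq]
  rw [neg_add, Polynomial.dickson_one_one_eval_add_inv _ _ h, neg_pow q, neg_pow q⁻¹, inv_pow,
    mul_add]

/-- An even minimal exponent `n` with `q ^ n = ± 1` has `q ^ n = -1`. -/
theorem pow_eq_neg_one_of_even_of_minimal {R : Type*} [Ring R] [NoZeroDivisors R] {q : R} {n : ℕ}
    (hn : 0 < n) (hqn : q ^ n = 1 ∨ q ^ n = -1)
    (hmin : ∀ k : ℕ, 0 < k → (q ^ k = 1 ∨ q ^ k = -1) → n ≤ k) (heven : Even n) :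
    q ^ n = -1 := by
  refine hqn.resolve_left fun h => ?_
  obtain ⟨k, rfl⟩ := heven
  rw [pow_add, mul_self_eq_one_iff] at h
  have := hmin k (by omega) h
  omega

/-- If `q` is a root of unity and `n` is the smallest positive integer with
`q^n ∈ {1, -1}`, then the Dickson polynomial `D_n = dickson 1 1 n` (the paper's
Chebyshev polynomial `T_n` of the first kind) satisfies
`T_n(-(q + q⁻¹)) = -q^(n^2) - (q^(n^2))⁻¹`. -/
theorem dickson_eval_neg (q : ℂ) (hq : ∃ m : ℕ, 0 < m ∧ q ^ m = 1)
    (n : ℕ) (hn : 0 < n) (hqn : q ^ n = 1 ∨ q ^ n = -1)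
    (hmin : ∀ k : ℕ, 0 < k → (q ^ k = 1 ∨ q ^ k = -1) → n ≤ k) :
    (Polynomial.dickson 1 (1 : ℂ) n).eval (-(q + q⁻¹)) =
      -q ^ (n ^ 2) - (q ^ (n ^ 2))⁻¹ := by
  have hq0 : q ≠ 0 := by
    rintro rfl
    simp [zero_pow hn.ne'] at hqn
  rw [dickson_one_one_eval_neg_add_inv hq0, sq, pow_mul]
  rcases Nat.even_or_odd n with he | ho
  · rw [pow_eq_neg_one_of_even_of_minimal hn hqn hmin he, he.neg_one_pow]
    norm_num
  · rcases hqn with h | h <;> rw [h, ho.neg_one_pow] <;> norm_num
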